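/- arXiv:2403.02413 — 7 statements merged into one kernel-verified Lean document; each statement's English description precedes it below -/
import Mathlib

section
/- Let (A⁺, v) be a semi-valuation ring with valuative ideal 𝔭 = v⁻¹(0) and quotient map π : A⁺ → V := A⁺/𝔭. Then A⁺ is a local ring, and an element x ∈ A⁺ is a unit of A⁺ if and only if π(x) is a unit of V; equivalently, the maximal ideal of A⁺ is π⁻¹(m_V), the preimage of the maximal ideal of the valuation ring V. -/
/-- Temkin's notion of a semi-valuation ring: a valuation `v` on a commutative ring `A⁺`
(`v 1 = 1`, `v (x*y) = v x * v y`, `v (x+y) ≤ max (v x) (v y)`, values in a linearly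
ordered group with zero) such that
(i) every zero divisor of `A⁺` lies in the support `𝔭 = v⁻¹(0)` of `v`, and
(ii) for all `x y` with `v x ≤ v y ≠ 0` one has `y ∣ x`. -/
def IsSemiValuation {A : Type*} [CommRing A] {Γ : Type*}
    [LinearOrderedCommGroupWithZero Γ] (v : Valuation A Γ) : Prop :=
  (∀ x y : A, x * y = 0 → y ≠ 0 → v x = 0) ∧
  (∀ x y : A, v x ≤ v y → v y ≠ 0 → y ∣ x)

/-- In a semi-valuation ring every element of valuation at least `1` is a unit. -/
theorem IsSemiValuation.isUnit_of_one_le {A : Type*} [CommRing A] {Γ : Type*}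
    [LinearOrderedCommGroupWithZero Γ] {v : Valuation A Γ} (hv : IsSemiValuation v)
    {x : A} (hx : 1 ≤ v x) : IsUnit x :=
  isUnit_of_dvd_one (hv.2 1 x (by rwa [map_one]) (zero_lt_one.trans_le hx).ne')

/-- A semi-valuation ring `(A⁺, v)` with valuative ideal `𝔭 = v.supp`
and quotient map `π : A⁺ → V = A⁺/𝔭` is a local ring, and `x ∈ A⁺` is a unit of `A⁺`
if and only if `π x` is a unit of `V`; equivalently, the maximal ideal of `A⁺` is the
preimage under `π` of the maximal ideal of the valuation ring `V` (the set of nonunits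
of `A⁺` is the preimage of the set of nonunits of `V`). -/
theorem semiValuationRing_isLocalRing_units_iff
    {A : Type*} [CommRing A] {Γ : Type*} [LinearOrderedCommGroupWithZero Γ]
    (v : Valuation A Γ) (hv : IsSemiValuation v) :
    IsLocalRing A ∧
      ∀ x : A, IsUnit x ↔ IsUnit (Ideal.Quotient.mk v.supp x) := by
  have : Nontrivial A := domain_nontrivial v v.map_zero v.map_one
  refine ⟨⟨fun {a b} hab => ?_⟩, fun x =>
    ⟨fun hx => hx.map _, fun hx => ?_⟩⟩
  · have h : 1 ≤ max (v a) (v b) := by simpa [hab] using v.map_add a b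
    exact (le_max_iff.mp h).imp hv.isUnit_of_one_le hv.isUnit_of_one_le
  · obtain ⟨b, hb⟩ := isUnit_iff_exists_inv.mp hx
    obtain ⟨y, rfl⟩ := Ideal.Quotient.mk_surjective b
    rw [← map_mul, ← map_one (Ideal.Quotient.mk v.supp), Ideal.Quotient.eq,
      Valuation.mem_supp_iff] at hb
    have hxy : v (x * y) = 1 := by
      rw [← v.map_one]
      exact v.map_eq_of_sub_lt (by simp [hb])
    exact isUnit_of_mul_isUnit_left (hv.isUnit_of_one_le hxy.ge)
end

section
/- Let (A⁺, v) be a semi-valuation ring with valuative ideal 𝔭 = v⁻¹(0) and semi-fraction ring A := A⁺_𝔭. Then: (a) the localization map A⁺ → A is injective; (b) the subset 𝔭 of A⁺ is stable under multiplication by A, i.e. 𝔭·A = 𝔭 inside A (so 𝔭 is an ideal of A); and (c) identifying A⁺ with its image in A, an element a ∈ A lies in A⁺ if and only if its residue class in k := A/𝔭 lies in the image of the injective map V := A⁺/𝔭 → k. In other words, the square with vertices A⁺, A, V, k is a Milnor square (a bicartesian square of commutative rings in which the two vertical maps are surjective). -/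
namespace IsSemiValuation

variable {A : Type*} [CommRing A] {Γ : Type*} [LinearOrderedCommGroupWithZero Γ]
  {v : Valuation A Γ}

theorem primeCompl_supp_le_nonZeroDivisors (hv : IsSemiValuation v) :
    v.supp.primeCompl ≤ nonZeroDivisors A := by
  intro s hs
  rw [mem_nonZeroDivisors_iff_right]
  intro x hx
  by_contra hne
  exact hs (hv.1 s x (by rw [mul_comm, hx]) hne)

theorem algebraMap_injective (hv : IsSemiValuation v) :
    Function.Injective (algebraMap A (Localization.AtPrime v.supp)) :=
  IsLocalization.injective _ hv.primeCompl_supp_le_nonZeroDivisors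

theorem coe_map_supp (hv : IsSemiValuation v) :
    (Ideal.map (algebraMap A (Localization.AtPrime v.supp)) v.supp :
      Set (Localization.AtPrime v.supp)) =
      algebraMap A (Localization.AtPrime v.supp) '' (v.supp : Set A) := by
  ext z
  constructor
  · intro hz
    obtain ⟨⟨⟨p, hp⟩, ⟨s, hs⟩⟩, h⟩ :=
      (IsLocalization.mem_map_algebraMap_iff v.supp.primeCompl _).1 hz
    have hp0 : v p = 0 := hp
    have hs0 : v s ≠ 0 := hs
    obtain ⟨q, rfl⟩ := hv.2 p s (by simp [hp0]) hs0
    refine ⟨q, ?_, ?_⟩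
    · rw [map_mul] at hp0
      exact (mul_eq_zero.1 hp0).resolve_left hs0
    · have hu := IsLocalization.map_units (Localization.AtPrime v.supp)
        (⟨s, hs⟩ : v.supp.primeCompl)
      apply hu.mul_right_cancel
      simpa [mul_comm] using h.symm
  · rintro ⟨p, hp, rfl⟩
    exact Ideal.mem_map_of_mem _ hp

theorem comap_map_supp (hv : IsSemiValuation v) :
    (v.supp.map (algebraMap A (Localization.AtPrime v.supp))).comap
      (algebraMap A (Localization.AtPrime v.supp)) = v.supp := by
  apply SetLike.coe_injective
  rw [Ideal.coe_comap, hv.coe_map_supp, Set.preimage_image_eq _ hv.algebraMap_injective]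

end IsSemiValuation

/-- For a semi-valuation ring `(A⁺, v)` with valuative ideal `𝔭 = v.supp`
and semi-fraction ring `A = A⁺_𝔭` (the localization at `𝔭`):
(a) the localization map `A⁺ → A` is injective;
(b) the ideal of `A` generated by the image of `𝔭` is exactly the image of `𝔭`
    (i.e. `𝔭·A = 𝔭`, so `𝔭` is an ideal of `A`);
(c) the induced map `V = A⁺/𝔭 → k = A/𝔭A` is injective, and an element `a ∈ A` lies in
    the image of `A⁺` if and only if its residue class in `k` lies in the image of `V`.
In other words, the square `A⁺ → A`, `A⁺ → V`, `A → k`, `V → k` is a Milnor square. -/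
theorem semiValuationRing_milnor_square
    {A : Type*} [CommRing A] {Γ : Type*} [LinearOrderedCommGroupWithZero Γ]
    (v : Valuation A Γ) (hv : IsSemiValuation v) :
    Function.Injective (algebraMap A (Localization.AtPrime v.supp)) ∧
    ((Ideal.map (algebraMap A (Localization.AtPrime v.supp)) v.supp : Set (Localization.AtPrime v.supp))
      = algebraMap A (Localization.AtPrime v.supp) '' (v.supp : Set A)) ∧
    Function.Injective (Ideal.quotientMap
      (Ideal.map (algebraMap A (Localization.AtPrime v.supp)) v.supp)
      (algebraMap A (Localization.AtPrime v.supp)) Ideal.le_comap_map) ∧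
    ∀ a : Localization.AtPrime v.supp,
      a ∈ Set.range (algebraMap A (Localization.AtPrime v.supp)) ↔
        Ideal.Quotient.mk (Ideal.map (algebraMap A (Localization.AtPrime v.supp)) v.supp) a
          ∈ Set.range (fun x : A =>
            Ideal.Quotient.mk (Ideal.map (algebraMap A (Localization.AtPrime v.supp)) v.supp)
              (algebraMap A (Localization.AtPrime v.supp) x)) := by
  refine ⟨hv.algebraMap_injective, hv.coe_map_supp,
    Ideal.quotientMap_injective' hv.comap_map_supp.le, fun a => ⟨?_, ?_⟩⟩
  · rintro ⟨x, rfl⟩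
    exact ⟨x, rfl⟩
  · rintro ⟨x, hx⟩
    have hmem := Ideal.Quotient.eq.1 hx.symm
    rw [← SetLike.mem_coe, hv.coe_map_supp] at hmem
    obtain ⟨p, -, hp⟩ := hmem
    exact ⟨p + x, by rw [map_add, hp, sub_add_cancel]⟩
end

section
/- Let (A, 𝔪) be a commutative local ring with residue field k = A/𝔪 and quotient map π : A → k, let V be a valuation subring of k, and set A⁺ := π⁻¹(V), a subring of A containing 𝔪. Then: (a) every zero divisor of A⁺ lies in 𝔪; and (b) for all x, y ∈ A⁺ such that π(y) ≠ 0 and π(x) ∈ π(y)·V, one has y ∣ x in A⁺. (Consequently A⁺, equipped with the valuation induced by the composite A⁺ → V → (V∖{0})/V^× ∪ {0}, is a semi-valuation ring with valuative ideal 𝔪.) -/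
/-- Let `(A, 𝔪)` be a commutative local ring with residue field
`k = A/𝔪` and quotient map `π = IsLocalRing.residue A`, let `V` be a valuation subring
of `k`, and let `A⁺ = π⁻¹(V)`. Then:
(a) every zero divisor of `A⁺` lies in `𝔪`; and
(b) for all `x, y ∈ A⁺` such that `π y ≠ 0` and `π x ∈ π y · V`, one has `y ∣ x` in `A⁺`.
(So `A⁺`, with the valuation induced by `A⁺ → V → (V∖{0})/V^× ∪ {0}`, is a semi-valuation
ring with valuative ideal `𝔪`.) -/
theorem preimage_of_valuation_subring_is_semiValuation
    {A : Type*} [CommRing A] [IsLocalRing A]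
    (V : ValuationSubring (IsLocalRing.ResidueField A)) :
    (∀ x y : Subring.comap (IsLocalRing.residue A) V.toSubring,
        x * y = 0 → y ≠ 0 → (x : A) ∈ IsLocalRing.maximalIdeal A) ∧
    (∀ x y : Subring.comap (IsLocalRing.residue A) V.toSubring,
        IsLocalRing.residue A (y : A) ≠ 0 →
        (∃ c ∈ V, IsLocalRing.residue A (x : A) = IsLocalRing.residue A (y : A) * c) →
        y ∣ x) := by
  refine ⟨fun x y hxy hy => ?_, fun x y hy ⟨c, hc, hxc⟩ => ?_⟩
  · rw [IsLocalRing.mem_maximalIdeal, mem_nonunits_iff]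
    intro hx
    have hxy' : (x : A) * (y : A) = 0 := congrArg Subtype.val hxy
    exact hy (Subtype.ext ((hx.mul_right_eq_zero).mp hxy'))
  · obtain ⟨z, hz⟩ := (IsLocalRing.residue_ne_zero_iff_isUnit (y : A)).mp hy |>.dvd (a := (x : A))
    have hzc : IsLocalRing.residue A z = c := by
      rw [hz, map_mul] at hxc
      exact mul_left_cancel₀ hy hxc
    exact ⟨⟨z, show IsLocalRing.residue A z ∈ V from hzc ▸ hc⟩, Subtype.ext hz⟩
end

section
/- Let (A, 𝔪) be a commutative local ring with residue field k = A/𝔪 and quotient map π : A → k, let V be a valuation subring of k, and set A⁺ := π⁻¹(V). Then: (a) A⁺ is a local ring whose units are exactly the elements x ∈ A⁺ with π(x) a unit of V; (b) 𝔪 is a prime ideal of A⁺; and (c) the inclusion A⁺ ↪ A exhibits A as the localization of A⁺ at the prime ideal 𝔪 (i.e. A satisfies the universal property IsLocalization at the prime 𝔪 of A⁺). -/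
open IsLocalRing

section

variable {A : Type*} [CommRing A] [IsLocalRing A]

/-- The residue map restricted to the preimage of a valuation subring of the residue field. -/
noncomputable def residueComap (V : ValuationSubring (ResidueField A)) :
    Subring.comap (residue A) V.toSubring →+* V :=
  ((residue A).comp (Subring.subtype _)).codRestrict V.toSubring fun x => x.2

theorem coe_residueComap (V : ValuationSubring (ResidueField A))
    (x : Subring.comap (residue A) V.toSubring) :
    (residueComap V x : ResidueField A) = residue A (x : A) :=
  rfl

instance isLocalHom_residueComap (V : ValuationSubring (ResidueField A)) :
    IsLocalHom (residueComap V) where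
  map_nonunit x hx := by
    obtain ⟨v, hv⟩ := hx.exists_right_inv
    have hxv : residue A (x : A) * (v : ResidueField A) = 1 := by
      simpa [coe_residueComap] using congrArg (Subtype.val : V → ResidueField A) hv
    obtain ⟨b, hb⟩ := ((isUnit_map_iff (residue A) (x : A)).1
      (IsUnit.of_mul_eq_one _ hxv)).exists_right_inv
    have hbv : residue A b = v :=
      (left_inv_eq_right_inv (mul_comm (residue A (x : A)) v ▸ hxv)
        (by rw [← map_mul, hb, map_one])).symm
    exact IsUnit.of_mul_eq_one (⟨b, show residue A b ∈ V from hbv ▸ v.2⟩ :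
      Subring.comap (residue A) V.toSubring) (Subtype.ext hb)

theorem isUnit_comap_residue_iff (V : ValuationSubring (ResidueField A))
    (x : Subring.comap (residue A) V.toSubring) :
    IsUnit x ↔ ∃ u : V, IsUnit u ∧ (u : ResidueField A) = residue A (x : A) := by
  rw [← isUnit_map_iff (residueComap V) x]
  refine ⟨fun h => ⟨_, h, rfl⟩, fun ⟨u, hu, h⟩ => ?_⟩
  rwa [← show u = residueComap V x from Subtype.ext h]

theorem exists_mul_mem_comap_residue (V : ValuationSubring (ResidueField A)) (a : A) :
    ∃ s ∈ Subring.comap (residue A) V.toSubring,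
      IsUnit s ∧ a * s ∈ Subring.comap (residue A) V.toSubring := by
  by_cases ha : residue A a ∈ V
  · exact ⟨1, one_mem _, isUnit_one, by rwa [mul_one]⟩
  · have hunit : IsUnit a := by
      by_contra h
      exact ha ((residue_eq_zero_iff a).2 h ▸ zero_mem V)
    obtain ⟨b, hb⟩ := hunit.exists_right_inv
    have hinv : residue A b = (residue A a)⁻¹ :=
      eq_inv_of_mul_eq_one_right (by rw [← map_mul, hb, map_one])
    refine ⟨b, ?_, IsUnit.of_mul_eq_one a (mul_comm a b ▸ hb), hb ▸ one_mem _⟩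
    change residue A b ∈ V
    exact hinv ▸ (V.mem_or_inv_mem _).resolve_left ha

end

/-- Let `(A, 𝔪)` be a commutative local ring with residue field
`k = A/𝔪` and quotient map `π = IsLocalRing.residue A`, let `V` be a valuation subring
of `k`, and let `A⁺ = π⁻¹(V)`. Then:
(a) `A⁺` is a local ring whose units are exactly the elements `x` with `π x` a unit of `V`;
(b) `𝔪` (i.e. the pullback of the maximal ideal of `A` to `A⁺`) is a prime ideal of `A⁺`;
(c) the inclusion `A⁺ ↪ A` exhibits `A` as the localization of `A⁺` at the prime `𝔪`. -/
theorem preimage_of_valuation_subring_local_and_localization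
    {A : Type*} [CommRing A] [IsLocalRing A]
    (V : ValuationSubring (IsLocalRing.ResidueField A)) :
    IsLocalRing (Subring.comap (IsLocalRing.residue A) V.toSubring) ∧
    (∀ x : Subring.comap (IsLocalRing.residue A) V.toSubring,
        IsUnit x ↔ ∃ u : V, IsUnit u ∧ (u : IsLocalRing.ResidueField A) =
          IsLocalRing.residue A (x : A)) ∧
    ∃ hP : (Ideal.comap (Subring.subtype (Subring.comap (IsLocalRing.residue A) V.toSubring))
        (IsLocalRing.maximalIdeal A)).IsPrime,
      IsLocalization
        (@Ideal.primeCompl _ _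
          (Ideal.comap (Subring.subtype (Subring.comap (IsLocalRing.residue A) V.toSubring))
            (IsLocalRing.maximalIdeal A)) hP) A := by
  refine ⟨RingHom.domain_isLocalRing (residueComap V), isUnit_comap_residue_iff V,
    inferInstance, ?_, ?_, ?_⟩
  · rintro ⟨x, hx⟩
    exact not_not.1 hx
  · intro a
    obtain ⟨s, hs, hunit, has⟩ := exists_mul_mem_comap_residue V a
    exact ⟨⟨⟨_, has⟩, ⟨⟨s, hs⟩, not_not.2 hunit⟩⟩, rfl⟩
  · intro x y hxy
    exact ⟨1, by rw [Subtype.ext hxy]⟩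
end

section
/- Let (A⁺, v) be a semi-valuation ring with non-trivial valuation, maximal ideal 𝔪⁺, and residue field A⁺/𝔪⁺. Then Tor₂^{A⁺}(M, A⁺/𝔪⁺) = 0 for every A⁺-module M. -/
open CategoryTheory

universe u

/-- An ideal is flat if any finite family of its elements has a common divisor in the ideal
which is a non-zero-divisor. -/
theorem Ideal.flat_of_forall_exists_dvd {R : Type*} [CommRing R] (I : Ideal R)
    (h : ∀ s : Finset I, ∃ y ∈ I, y ∈ nonZeroDivisors R ∧ ∀ x ∈ s, y ∣ (x : R)) :
    Module.Flat R I := by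
  classical
  refine Module.Flat.of_forall_isTrivialRelation fun {l f x} hfx ↦ ?_
  obtain ⟨y, hyI, hy, hdvd⟩ := h (Finset.univ.image x)
  choose a ha using fun i ↦ hdvd (x i) (Finset.mem_image_of_mem x (Finset.mem_univ i))
  refine ⟨1, fun i _ ↦ a i, fun _ ↦ ⟨y, hyI⟩, fun i ↦ ?_, fun _ ↦ ?_⟩
  · ext
    simp [ha, mul_comm]
  · refine (mem_nonZeroDivisors_iff.mp hy).2 _ ?_
    have := congr_arg (Subtype.val : I → R) hfx
    simp only [AddSubmonoidClass.coe_finsetSum, Submodule.coe_smul, smul_eq_mul, ha,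
      ZeroMemClass.coe_zero] at this
    rw [← this, Finset.sum_mul]
    exact Finset.sum_congr rfl fun i _ ↦ by ring

namespace IsSemiValuation

variable {A : Type*} [CommRing A] {Γ : Type*} [LinearOrderedCommGroupWithZero Γ]
  {v : Valuation A Γ}

theorem mem_nonZeroDivisors (hv : IsSemiValuation v) {y : A} (hy : v y ≠ 0) :
    y ∈ nonZeroDivisors A := by
  rw [mem_nonZeroDivisors_iff_right]
  intro a ha
  by_contra h
  exact hy (hv.1 y a (by rwa [mul_comm]) h)

theorem exists_dvd_of_finset (hv : IsSemiValuation v) {I : Ideal A} (hI : ∃ y ∈ I, v y ≠ 0)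
    (s : Finset I) : ∃ y ∈ I, v y ≠ 0 ∧ ∀ x ∈ s, y ∣ (x : A) := by
  classical
  induction s using Finset.induction_on with
  | empty => simpa using hI
  | insert x s _ ih =>
    obtain ⟨y, hyI, hy, hdvd⟩ := ih
    rcases le_or_gt (v x) (v y) with hxy | hxy
    · exact ⟨y, hyI, hy, Finset.forall_mem_insert _ _ _ |>.mpr ⟨hv.2 _ _ hxy hy, hdvd⟩⟩
    · have hx : v x ≠ 0 := (zero_le.trans_lt hxy).ne'
      exact ⟨x, x.2, hx, Finset.forall_mem_insert _ _ _ |>.mpr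
        ⟨dvd_rfl, fun z hz ↦ (hv.2 _ _ hxy.le hx).trans (hdvd z hz)⟩⟩

theorem flat_ideal (hv : IsSemiValuation v) {I : Ideal A} (hI : ∃ y ∈ I, v y ≠ 0) :
    Module.Flat A I :=
  I.flat_of_forall_exists_dvd fun s ↦
    let ⟨y, hyI, hy, hdvd⟩ := hv.exists_dvd_of_finset hI s
    ⟨y, hyI, hv.mem_nonZeroDivisors hy, hdvd⟩

end IsSemiValuation

theorem Valuation.exists_mem_maximalIdeal_ne_zero {A : Type*} [CommRing A] [IsLocalRing A]
    {Γ : Type*} [LinearOrderedCommGroupWithZero Γ] (v : Valuation A Γ)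
    (hnt : ¬ IsField (A ⧸ v.supp)) : ∃ y ∈ IsLocalRing.maximalIdeal A, v y ≠ 0 := by
  by_contra! h
  refine hnt ((Ideal.Quotient.maximal_ideal_iff_isField_quotient _).mp ?_)
  rw [← (IsLocalRing.maximalIdeal.isMaximal A).eq_of_le
    (Ideal.IsPrime.ne_top inferInstance : v.supp ≠ ⊤) h]
  exact IsLocalRing.maximalIdeal.isMaximal A

theorem Module.Flat.lTensor_eq_zero_of_subtype_rTensor_eq_zero {R M L : Type*} [CommRing R]
    [AddCommGroup M] [AddCommGroup L] [Module R M] [Module R L] [Module.Flat R L] {I : Ideal R}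
    (φ : M →ₗ[R] L) {t : TensorProduct R I M} (ht : I.subtype.rTensor M t = 0) :
    φ.lTensor I t = 0 := by
  refine (injective_iff_map_eq_zero _).mp (Module.Flat.rTensor_preserves_injective_linearMap
    (M := L) I.subtype I.subtype_injective) _ ?_
  rw [← LinearMap.comp_apply, LinearMap.rTensor_comp_lTensor, ← LinearMap.lTensor_comp_rTensor,
    LinearMap.comp_apply, ht, map_zero]

theorem Module.Flat.prod {R M N : Type*} [CommRing R] [AddCommGroup M] [AddCommGroup N]
    [Module R M] [Module R N] [Module.Flat R M] [Module.Flat R N] : Module.Flat R (M × N) := by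
  refine Module.Flat.iff_rTensor_injective'.mpr fun I ↦ (injective_iff_map_eq_zero _).mpr
    fun t ht ↦ ?_
  have hid : (LinearMap.id : M × N →ₗ[R] M × N) =
      LinearMap.inl R M N ∘ₗ LinearMap.fst R M N + LinearMap.inr R M N ∘ₗ LinearMap.snd R M N := by
    ext <;> simp
  rw [← LinearMap.id_apply (R := R) t, ← LinearMap.lTensor_id, hid, LinearMap.lTensor_add,
    LinearMap.add_apply, LinearMap.lTensor_comp_apply, LinearMap.lTensor_comp_apply,
    lTensor_eq_zero_of_subtype_rTensor_eq_zero _ ht,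
    lTensor_eq_zero_of_subtype_rTensor_eq_zero _ ht, map_zero, map_zero, add_zero]

/-- A form of Schanuel's lemma: if `k` has a surjection from a projective module whose kernel
is flat, then the kernel of every surjection from a projective module onto `k` is flat. -/
theorem Module.Flat.ker_of_projective {R P Q k : Type*} [CommRing R] [AddCommGroup P]
    [AddCommGroup Q] [AddCommGroup k] [Module R P] [Module R Q] [Module R k]
    [Module.Projective R P] [Module.Projective R Q] (p : P →ₗ[R] k) (q : Q →ₗ[R] k)
    (hp : Function.Surjective p) (hq : Function.Surjective q)
    [Module.Flat R (LinearMap.ker q)] : Module.Flat R (LinearMap.ker p) := by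
  obtain ⟨f, hf⟩ := Module.projective_lifting_property q p hq
  obtain ⟨g, hg⟩ := Module.projective_lifting_property p q hp
  have hf' (x) : q (f x) = p x := LinearMap.congr_fun hf x
  have hg' (x) : p (g x) = q x := LinearMap.congr_fun hg x
  let i : LinearMap.ker p →ₗ[R] LinearMap.ker q × P :=
    ((f ∘ₗ (LinearMap.ker p).subtype).codRestrict (LinearMap.ker q)
      fun x ↦ by simp [hf']).prod (LinearMap.ker p).subtype
  let r : LinearMap.ker q × P →ₗ[R] LinearMap.ker p :=
    ((g ∘ₗ (LinearMap.ker q).subtype).coprod (LinearMap.id - g ∘ₗ f)).codRestrict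
      (LinearMap.ker p) fun x ↦ by simp [hf', hg']
  have := Module.Flat.prod (R := R) (M := LinearMap.ker q) (N := P)
  refine Module.Flat.of_retract i r ?_
  refine LinearMap.ext fun x ↦ Subtype.ext ?_
  change g (f x) + ((x : P) - g (f x)) = x
  exact add_sub_cancel _ _

/-- Tensoring preserves exactness of `P₃ → P₂ → P₁` if the cokernel of `P₂ → P₁` is flat. -/
theorem Module.Flat.lTensor_exact_of_flat_range {R P₃ P₂ P₁ P₀ : Type*} [CommRing R]
    [AddCommGroup P₃] [AddCommGroup P₂] [AddCommGroup P₁] [AddCommGroup P₀]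
    [Module R P₃] [Module R P₂] [Module R P₁] [Module R P₀]
    (d₃ : P₃ →ₗ[R] P₂) (d₂ : P₂ →ₗ[R] P₁) (d₁ : P₁ →ₗ[R] P₀)
    (h₃₂ : Function.Exact d₃ d₂) (h₂₁ : Function.Exact d₂ d₁)
    [Module.Flat R (LinearMap.range d₁)] (M : Type*) [AddCommGroup M] [Module R M] :
    Function.Exact (d₃.lTensor M) (d₂.lTensor M) := by
  have hex : Function.Exact d₃ d₂.rangeRestrict := fun x ↦ by
    rw [← h₃₂ x]
    exact Subtype.ext_iff
  have hinj : Function.Injective ((LinearMap.range d₂).subtype.lTensor M) := by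
    refine LinearMap.lTensor_injective_of_exact_of_flat d₁.rangeRestrict
      d₁.surjective_rangeRestrict _ (Submodule.subtype_injective _) (fun x ↦ ?_) M
    rw [Submodule.coe_subtype, Subtype.range_coe]
    exact Subtype.ext_iff.trans (h₂₁ x)
  have hcomp : d₂.lTensor M =
      (LinearMap.range d₂).subtype.lTensor M ∘ₗ d₂.rangeRestrict.lTensor M := by
    rw [← LinearMap.lTensor_comp, LinearMap.subtype_comp_codRestrict]
  rw [hcomp, LinearMap.coe_comp]
  exact (_root_.lTensor_exact M hex d₂.surjective_rangeRestrict).comp_injective _ hinj (map_zero _)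

/-- Let `(A⁺, v)` be a semi-valuation ring (a local ring, with maximal
ideal `𝔪⁺` and residue field `A⁺/𝔪⁺`) whose valuation is non-trivial, i.e. the valuation
ring `V = A⁺/v.supp` is not a field. Then `Tor₂^{A⁺}(M, A⁺/𝔪⁺) = 0` for every
`A⁺`-module `M`. -/
theorem tor_two_residueField_isZero_of_semiValuation
    {A : Type u} [CommRing A] [IsLocalRing A] {Γ : Type*}
    [LinearOrderedCommGroupWithZero Γ]
    (v : Valuation A Γ) (hv : IsSemiValuation v)
    (hnt : ¬ IsField (A ⧸ v.supp))
    (M : Type u) [AddCommGroup M] [Module A M] :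
    Limits.IsZero (((Tor (ModuleCat.{u} A) 2).obj (ModuleCat.of A M)).obj
      (ModuleCat.of A (IsLocalRing.ResidueField A))) := by
  have hm : Module.Flat A (IsLocalRing.maximalIdeal A) :=
    hv.flat_ideal (v.exists_mem_maximalIdeal_ne_zero hnt)
  let k := ModuleCat.of A (IsLocalRing.ResidueField A)
  let P := projectiveResolution k
  have hproj : Module.Projective A (P.complex.X 0) :=
    (IsProjective.iff_projective _).mpr (P.projective 0)
  let p : P.complex.X 0 →ₗ[A] IsLocalRing.ResidueField A := (P.π.f 0).hom
  have hp : Function.Surjective p := (ModuleCat.epi_iff_surjective (P.π.f 0)).mp inferInstance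
  let q : A →ₗ[A] IsLocalRing.ResidueField A := (IsLocalRing.maximalIdeal A).mkQ
  have hq : Function.Surjective q := Submodule.mkQ_surjective _
  have hqker : LinearMap.ker q = IsLocalRing.maximalIdeal A := Submodule.ker_mkQ _
  have : Module.Flat A (LinearMap.ker q) := hqker ▸ hm
  have hK : Module.Flat A (LinearMap.ker p) := Module.Flat.ker_of_projective p q hp hq
  have h₀ : LinearMap.range (P.complex.d 1 0).hom = LinearMap.ker p :=
    P.exact₀.moduleCat_range_eq_ker
  have : Module.Flat A (LinearMap.range (P.complex.d 1 0).hom) := h₀ ▸ hK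
  have hex := Module.Flat.lTensor_exact_of_flat_range (P.complex.d 3 2).hom (P.complex.d 2 1).hom
    (P.complex.d 1 0).hom
    ((ShortComplex.ShortExact.moduleCat_exact_iff_function_exact _).mp (P.exact_succ 1))
    ((ShortComplex.ShortExact.moduleCat_exact_iff_function_exact _).mp (P.exact_succ 0)) M
  refine Limits.IsZero.of_iso ?_ (P.isoLeftDerivedObj
    ((MonoidalCategory.tensoringLeft (ModuleCat.{u} A)).obj (ModuleCat.of A M)) 2)
  refine HomologicalComplex.ExactAt.isZero_homology ?_
  rw [HomologicalComplex.exactAt_iff' _ 3 2 1 (by simp) (by simp),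
    ShortComplex.ShortExact.moduleCat_exact_iff_function_exact]
  exact hex
end

section
/- Let (A⁺, v) be a semi-valuation ring with valuative ideal 𝔭 = v⁻¹(0), regarded (via the injective localization map) as a subring of its semi-fraction ring A = A⁺_𝔭, and let X, Y ∈ 𝔭 be a regular sequence on A⁺ (i.e. X is a non-zero-divisor on A⁺ and Y is a non-zero-divisor on A⁺/XA⁺). Then the kernel of the A⁺-linear map φ : A⁺ × A⁺ → A⁺, (f,g) ↦ fX − gY, equals { (aY, aX) : a ∈ A }; here aY, aX ∈ 𝔭 ⊆ A⁺ for all a ∈ A since 𝔭 is an ideal of A. -/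
/-- The localization map of a semi-valuation ring to its semi-fraction ring is injective. -/
theorem IsSemiValuation.algebraMap_injective_s13
    {A : Type*} [CommRing A] {Γ : Type*} [LinearOrderedCommGroupWithZero Γ]
    {v : Valuation A Γ} (hv : IsSemiValuation v) :
    Function.Injective (algebraMap A (Localization.AtPrime v.supp)) := by
  refine (injective_iff_map_eq_zero _).2 fun x hx => ?_
  obtain ⟨s, hs⟩ := (IsLocalization.map_eq_zero_iff v.supp.primeCompl _ x).1 hx
  by_contra hx0
  exact s.2 ((Valuation.mem_supp_iff v _).2 (hv.1 _ _ hs hx0))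

/-- Let `(A⁺, v)` be a semi-valuation ring with valuative ideal
`𝔭 = v.supp` and semi-fraction ring `A = A⁺_𝔭`, and let `X, Y ∈ 𝔭` be a regular sequence
on `A⁺` (`X` a non-zero-divisor and `Y` a non-zero-divisor modulo `X`). Then the kernel
of `φ : A⁺ × A⁺ → A⁺`, `(f, g) ↦ f·X − g·Y`, equals `{(aY, aX) : a ∈ A}`: a pair `(f, g)`
satisfies `f·X − g·Y = 0` iff there is `a ∈ A` with `f = a·Y` and `g = a·X` in `A`
(the elements `a·Y, a·X` of `A` automatically lie in `A⁺` since `𝔭` is an ideal of `A`). -/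
theorem ker_of_regular_sequence_map_semiValuation
    {A : Type*} [CommRing A] {Γ : Type*} [LinearOrderedCommGroupWithZero Γ]
    (v : Valuation A Γ) (hv : IsSemiValuation v)
    (X Y : A) (hX : v X = 0) (hY : v Y = 0)
    (hXreg : ∀ z : A, z * X = 0 → z = 0)
    (hYreg : ∀ z : A, X ∣ z * Y → X ∣ z) :
    ∀ f g : A, f * X - g * Y = 0 ↔
      ∃ a : Localization.AtPrime v.supp,
        algebraMap A (Localization.AtPrime v.supp) f
            = a * algebraMap A (Localization.AtPrime v.supp) Y ∧
        algebraMap A (Localization.AtPrime v.supp) g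
            = a * algebraMap A (Localization.AtPrime v.supp) X := by
  intro f g
  constructor
  · intro h
    obtain ⟨c, rfl⟩ := hYreg g ⟨f, by linear_combination -h⟩
    have hf : f = c * Y := sub_eq_zero.1 (hXreg _ (by linear_combination h))
    exact ⟨algebraMap A _ c, by rw [hf, map_mul], by rw [mul_comm X, map_mul]⟩
  · rintro ⟨a, hf, hg⟩
    apply hv.algebraMap_injective_s13
    rw [map_sub, map_mul, map_mul, hf, hg, map_zero]
    ring
end

section
/- Let (A⁺, v) be a semi-valuation ring with valuative ideal 𝔭 = v⁻¹(0), semi-fraction ring A = A⁺_𝔭, valuation ring V = A⁺/𝔭 with quotient map π : A⁺ → V, and let s ∈ A⁺ be an element whose image s̄ = π(s) in V is nonzero and satisfies V[s̄⁻¹] = Frac(V) (i.e. every nonzero element of V divides some power of s̄). Then: (a) the image of s in A is a unit; (b) 𝔭 ⊆ sⁿA⁺ for every n ≥ 0; (c) the map A⁺ → A exhibits A as the localization of A⁺ away from s, i.e. A = A⁺[s⁻¹]; and (d) for every n ≥ 1, π induces a ring isomorphism A⁺/sⁿA⁺ ≅ V/s̄ⁿV (so π is an analytic isomorphism along {sⁿ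 : n ∈ ℕ}). -/
namespace IsSemiValuation

variable {A : Type*} [CommRing A] {Γ : Type*} [LinearOrderedCommGroupWithZero Γ]
  {v : Valuation A Γ}

/-- Elements outside the valuative ideal divide every element of the valuative ideal. -/
theorem dvd_of_mem_supp (hv : IsSemiValuation v) {x p : A} (hx : v x ≠ 0) (hp : p ∈ v.supp) :
    x ∣ p :=
  hv.2 p x (((Valuation.mem_supp_iff v p).mp hp).trans_le zero_le) hx

/-- Divisibility by an element outside the valuative ideal can be tested modulo that ideal. -/
theorem dvd_of_mk_dvd_mk (hv : IsSemiValuation v) {x y : A} (hx : v x ≠ 0)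
    (h : Ideal.Quotient.mk v.supp x ∣ Ideal.Quotient.mk v.supp y) : x ∣ y := by
  obtain ⟨w, hw⟩ := h
  obtain ⟨w, rfl⟩ := Ideal.Quotient.mk_surjective w
  rw [← map_mul, Ideal.Quotient.eq] at hw
  exact (dvd_sub_left (dvd_mul_right x w)).mp (hv.dvd_of_mem_supp hx hw)

end IsSemiValuation

/-- Let `(A⁺, v)` be a semi-valuation ring with valuative ideal
`𝔭 = v.supp`, semi-fraction ring `A = A⁺_𝔭`, valuation ring `V = A⁺/𝔭` with quotient
map `π`, and let `s ∈ A⁺` with `s̄ = π s ≠ 0` such that `V[s̄⁻¹] = Frac V`, i.e. every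
nonzero element of `V` divides a power of `s̄`. Then:
(a) the image of `s` in `A` is a unit;
(b) `𝔭 ⊆ sⁿA⁺` for every `n ≥ 0`;
(c) `A⁺ → A` exhibits `A` as the localization of `A⁺` away from `s`; and
(d) for every `n ≥ 1`, `π` induces a ring isomorphism `A⁺/sⁿA⁺ ≅ V/s̄ⁿV`
    (so `π` is an analytic isomorphism along `{sⁿ}`). -/
theorem semiValuation_analytic_iso_along_s
    {A : Type*} [CommRing A] {Γ : Type*} [LinearOrderedCommGroupWithZero Γ]
    (v : Valuation A Γ) (hv : IsSemiValuation v)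
    (s : A) (hs : Ideal.Quotient.mk v.supp s ≠ 0)
    (hgen : ∀ z : A ⧸ v.supp, z ≠ 0 → ∃ n : ℕ, z ∣ (Ideal.Quotient.mk v.supp s) ^ n) :
    IsUnit (algebraMap A (Localization.AtPrime v.supp) s) ∧
    (∀ n : ℕ, v.supp ≤ Ideal.span {s ^ n}) ∧
    IsLocalization.Away s (Localization.AtPrime v.supp) ∧
    ∀ n : ℕ, 1 ≤ n → Function.Bijective
      (Ideal.quotientMap (Ideal.span {(Ideal.Quotient.mk v.supp s) ^ n})
        (Ideal.Quotient.mk v.supp)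
        (show Ideal.span {s ^ n} ≤ Ideal.comap (Ideal.Quotient.mk v.supp)
            (Ideal.span {(Ideal.Quotient.mk v.supp s) ^ n}) by
          rw [Ideal.span_le, Set.singleton_subset_iff]
          exact Ideal.mem_comap.mpr (by rw [map_pow]; exact Ideal.subset_span rfl))) := by
  have hvs : v s ≠ 0 := fun h => hs (Ideal.Quotient.eq_zero_iff_mem.mpr h)
  have hvpow (n : ℕ) : v (s ^ n) ≠ 0 := by
    rw [map_pow]
    exact pow_ne_zero n hvs
  have hsupp (n : ℕ) : v.supp ≤ Ideal.span {s ^ n} := fun _ hp =>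
    Ideal.mem_span_singleton.mpr (hv.dvd_of_mem_supp (hvpow n) hp)
  refine ⟨IsLocalization.map_units (M := v.supp.primeCompl) _ ⟨s, hvs⟩, hsupp, ?_,
    fun n _ => ⟨Ideal.quotientMap_injective' ?_,
      Ideal.quotientMap_surjective Ideal.Quotient.mk_surjective⟩⟩
  · have hle : Submonoid.powers s ≤ v.supp.primeCompl := Submonoid.powers_le.mpr hvs
    have hloc : IsLocalization v.supp.primeCompl (Localization.Away s) := by
      refine IsLocalization.of_le_of_exists_dvd (Submonoid.powers s) _ hle fun x hx => ?_
      obtain ⟨n, w, hw⟩ := hgen (Ideal.Quotient.mk v.supp x)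
        fun h => hx (Ideal.Quotient.eq_zero_iff_mem.mp h)
      refine ⟨s ^ n, ⟨n, rfl⟩, hv.dvd_of_mk_dvd_mk hx ⟨w, ?_⟩⟩
      rw [map_pow, hw]
    exact IsLocalization.isLocalization_of_algEquiv (Submonoid.powers s)
      (IsLocalization.algEquiv v.supp.primeCompl (Localization.Away s)
        (Localization.AtPrime v.supp))
  · intro x hx
    rw [Ideal.mem_comap, Ideal.mem_span_singleton, ← map_pow] at hx
    exact Ideal.mem_span_singleton.mpr (hv.dvd_of_mk_dvd_mk (hvpow n) hx)
end
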